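/- arXiv:1610.07891 — 2 statements merged into one kernel-verified Lean document; each statement's English description precedes it below -/
import Mathlib

section
/- Assume Q = q^2 where q is a power of the prime p. Let a, b ∈ H_J. Then the Hermitian inner product ev_J(X^a)·_h ev_J(X^b) = Σ_{P∈Z_J} P^a·(P^b)^q is nonzero if and only if both of the following hold: (1) for every j ∈ J, q·a_j + b_j ≡ 0 (mod N_j − 1); (2) for every j ∉ J, either a_j + b_j > 0 and q·a_j + b_j ≡ 0 (mod N_j − 1), or a_j = b_j = 0 and p does not divide N_j. -/
/-- A finite field contains a primitive `n`-th root of unity for every divisor `n` of the order of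
its multiplicative group. -/
theorem FiniteField.exists_isPrimitiveRoot {F : Type*} [Field F] [Fintype F]
    {n : ℕ} (hdvd : n ∣ Fintype.card F - 1) : ∃ ζ : F, IsPrimitiveRoot ζ n := by
  classical
  obtain ⟨c, hc⟩ := hdvd
  have hcard := Fintype.one_lt_card (α := F)
  obtain ⟨g, hg⟩ := IsCyclic.exists_generator (α := Fˣ)
  have hord : orderOf g = Fintype.card F - 1 := by
    rw [orderOf_eq_card_of_forall_mem_zpowers hg, Nat.card_eq_fintype_card, Fintype.card_units]
  have hgp : IsPrimitiveRoot (g : F) (Fintype.card F - 1) :=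
    IsPrimitiveRoot.coe_units_iff.2 (hord ▸ IsPrimitiveRoot.orderOf g)
  exact ⟨_, hgp.pow (by omega) (hc.trans (mul_comm n c))⟩

/-- A finite field has exactly `n` roots of `x ^ n = 1` when `n` divides the order of its
multiplicative group. -/
theorem FiniteField.card_filter_pow_eq_one {F : Type*} [Field F] [Fintype F] [DecidableEq F]
    {n : ℕ} (hn : 0 < n) (hdvd : n ∣ Fintype.card F - 1) :
    (Finset.univ.filter (fun x : F => x ^ n = 1)).card = n := by
  obtain ⟨ζ, hζ⟩ := FiniteField.exists_isPrimitiveRoot hdvd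
  refine Eq.trans (congrArg Finset.card ?_) hζ.card_nthRootsFinset
  ext x
  simp [Polynomial.mem_nthRootsFinset hn]

/-- In a finite field, the sum of the `k`-th powers of all `n`-th roots of unity, for `n` dividing
the order of the multiplicative group, is nonzero exactly when `n` divides `k`. -/
theorem sum_pow_filter_pow_eq_one_ne_zero_iff {F : Type*} [Field F] [Fintype F] [DecidableEq F]
    {n : ℕ} (hn : 0 < n) (hdvd : n ∣ Fintype.card F - 1) (k : ℕ) :
    ∑ x ∈ Finset.univ.filter (fun x : F => x ^ n = 1), x ^ k ≠ 0 ↔ n ∣ k := by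
  constructor
  · intro hsum
    by_contra hk
    obtain ⟨ζ, hζ⟩ := FiniteField.exists_isPrimitiveRoot hdvd
    have hζk : ζ ^ k ≠ 1 := fun h => hk (hζ.dvd_of_pow_eq_one k h)
    have hζ0 : ζ ≠ 0 := hζ.ne_zero hn.ne'
    have hinv : ζ ^ k * ∑ x ∈ Finset.univ.filter (fun x : F => x ^ n = 1), x ^ k =
        ∑ x ∈ Finset.univ.filter (fun x : F => x ^ n = 1), x ^ k := by
      rw [Finset.mul_sum]
      refine Finset.sum_equiv (Equiv.mulLeft₀ ζ hζ0) (fun x => ?_) (fun x _ => ?_)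
      · simp [mul_pow, hζ.pow_eq_one]
      · simp [mul_pow]
    exact hζk (mul_right_cancel₀ hsum (hinv.trans (one_mul _).symm))
  · rintro ⟨d, rfl⟩
    rw [Finset.sum_congr rfl (g := fun _ => (1 : F)) fun x hx => by
      rw [pow_mul, (Finset.mem_filter.1 hx).2, one_pow], Finset.sum_const,
      FiniteField.card_filter_pow_eq_one hn hdvd, nsmul_one]
    obtain ⟨c, hc⟩ := hdvd
    intro h0
    have hcast : ((Fintype.card F - 1 + 1 : ℕ) : F) = 0 := by
      rw [Nat.sub_add_cancel Fintype.card_pos, FiniteField.cast_card_eq_zero]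
    rw [hc] at hcast
    simp [h0] at hcast

/-- The points of `x ^ (n + 1) = x` are `0` and the `n`-th roots of unity, so a sum over them
splits accordingly. -/
theorem sum_filter_pow_succ_eq_self {F M : Type*} [Field F] [Fintype F] [DecidableEq F]
    [AddCommMonoid M] {n : ℕ} (hn : 0 < n) (f : F → M) :
    ∑ x ∈ Finset.univ.filter (fun x : F => x ^ (n + 1) = x), f x =
      f 0 + ∑ x ∈ Finset.univ.filter (fun x : F => x ^ n = 1), f x := by
  have hfilter : Finset.univ.filter (fun x : F => x ^ (n + 1) = x) =
      insert 0 (Finset.univ.filter (fun x : F => x ^ n = 1)) := by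
    ext x
    rcases eq_or_ne x 0 with rfl | hx
    · simp
    · simp [pow_succ, hx]
  rw [hfilter, Finset.sum_insert (by simp [hn.ne'])]

/-- In a finite field with `n` dividing the order of the multiplicative group, the sum of the
`k`-th powers over the points of `x ^ (n + 1) = x` vanishes unless `n ∣ k`; for `k = 0` it is the
number `n + 1` of points. -/
theorem sum_pow_filter_pow_succ_eq_self_ne_zero_iff {F : Type*} [Field F] [Fintype F]
    [DecidableEq F] (p : ℕ) [CharP F p] {n : ℕ} (hn : 0 < n) (hdvd : n ∣ Fintype.card F - 1)
    (k : ℕ) :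
    ∑ x ∈ Finset.univ.filter (fun x : F => x ^ (n + 1) = x), x ^ k ≠ 0 ↔
      (0 < k ∧ n ∣ k) ∨ (k = 0 ∧ ¬ p ∣ n + 1) := by
  rw [sum_filter_pow_succ_eq_self hn]
  rcases Nat.eq_zero_or_pos k with rfl | hk
  · rw [← CharP.cast_eq_zero_iff F p]
    simp [FiniteField.card_filter_pow_eq_one hn hdvd, add_comm]
  · rw [zero_pow hk.ne', zero_add, sum_pow_filter_pow_eq_one_ne_zero_iff hn hdvd]
    simp [hk, hk.ne']

/-- Modulo a divisor `n` of `q ^ 2 - 1`, multiplication by `q` swaps `a + b * q` and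
`q * a + b`. -/
theorem dvd_add_mul_iff_of_dvd_sq_sub_one {n q : ℕ} (h : n ∣ q ^ 2 - 1) (hq : 0 < q) (a b : ℕ) :
    n ∣ a + b * q ↔ n ∣ q * a + b := by
  have hq2 : 1 ≤ q ^ 2 := Nat.one_le_pow _ _ hq
  obtain ⟨c, hc⟩ := h
  have hsq : q ^ 2 = n * c + 1 := by omega
  constructor <;> intro hd
  · refine (Nat.dvd_add_right (dvd_mul_right n (c * b))).1 ?_
    have key : q * (a + b * q) = n * (c * b) + (q * a + b) := by
      rw [show q * (a + b * q) = q * a + b * q ^ 2 by ring, hsq]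
      ring
    exact key ▸ hd.mul_left q
  · refine (Nat.dvd_add_right (dvd_mul_right n (c * a))).1 ?_
    have key : q * (q * a + b) = n * (c * a) + (a + b * q) := by
      rw [show q * (q * a + b) = a * q ^ 2 + b * q by ring, hsq]
      ring
    exact key ▸ hd.mul_left q

/-- Proposition 2 of the paper. Hermitian inner product of the
evaluations of two monomials over the points of the `J`-affine variety is nonzero
iff the stated congruence conditions hold.  Here `Q = q ^ 2` with `q = p ^ e`. -/
theorem hermitian_inner_product_of_monomials_ne_zero_iff
    (p e m : ℕ) (hp : p.Prime) (he : 0 < e)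
    (F : Type) [Field F] [Fintype F] [DecidableEq F]
    (hF : Fintype.card F = (p ^ e) ^ 2)
    (N : Fin m → ℕ) (hN : ∀ j, 1 < N j)
    (hNdvd : ∀ j, (N j - 1) ∣ (Fintype.card F - 1))
    (J : Finset (Fin m))
    (a b : Fin m → ℕ)
    (ha : ∀ j, a j ≤ N j - 1 - (if j ∈ J then 1 else 0))
    (hb : ∀ j, b j ≤ N j - 1 - (if j ∈ J then 1 else 0)) :
    (∑ P ∈ Finset.univ.filter (fun x : Fin m → F =>
        ∀ j, (j ∈ J → x j ^ (N j - 1) = 1) ∧ (j ∉ J → x j ^ (N j) = x j)),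
      (∏ j, P j ^ a j) * (∏ j, P j ^ b j) ^ (p ^ e)) ≠ 0 ↔
    ((∀ j ∈ J, (N j - 1) ∣ (p ^ e * a j + b j)) ∧
     (∀ j ∉ J, (0 < a j + b j ∧ (N j - 1) ∣ (p ^ e * a j + b j)) ∨
        (a j = 0 ∧ b j = 0 ∧ ¬ p ∣ N j))) := by
  have := Fact.mk hp
  have : CharP F p := charP_of_card_eq_prime_pow (f := e * 2) (by rw [hF, pow_mul])
  have hq : 0 < p ^ e := pow_pos hp.pos e
  have hpos : ∀ j, 0 < N j - 1 := fun j => Nat.sub_pos_of_lt (hN j)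
  have hsucc : ∀ j, N j - 1 + 1 = N j := fun j => Nat.sub_add_cancel (hN j).le
  have hswap : ∀ j, N j - 1 ∣ a j + b j * p ^ e ↔ N j - 1 ∣ p ^ e * a j + b j := fun j =>
    dvd_add_mul_iff_of_dvd_sq_sub_one (hF ▸ hNdvd j) hq _ _
  have hfilter : Finset.univ.filter (fun x : Fin m → F =>
        ∀ j, (j ∈ J → x j ^ (N j - 1) = 1) ∧ (j ∉ J → x j ^ (N j) = x j)) =
      Fintype.piFinset fun j => Finset.univ.filter fun y : F =>
        (j ∈ J → y ^ (N j - 1) = 1) ∧ (j ∉ J → y ^ (N j) = y) := by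
    ext x
    simp
  have hmonomial : ∀ P : Fin m → F, (∏ j, P j ^ a j) * (∏ j, P j ^ b j) ^ (p ^ e) =
      ∏ j, P j ^ (a j + b j * p ^ e) := fun P => by
    simp only [← Finset.prod_pow, ← Finset.prod_mul_distrib, ← pow_mul, ← pow_add]
  simp only [hfilter, hmonomial]
  rw [← Finset.prod_univ_sum _ fun j (y : F) => y ^ (a j + b j * p ^ e), Finset.prod_ne_zero_iff,
    ← forall_and]
  refine forall_congr' fun j => ?_
  by_cases hj : j ∈ J
  · simp only [hj, Finset.mem_univ, forall_const, not_true_eq_false, false_imp_iff, and_true]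
    rw [sum_pow_filter_pow_eq_one_ne_zero_iff (hpos j) (hNdvd j), hswap]
  · simp only [hj, Finset.mem_univ, forall_const, not_false_eq_true, false_imp_iff, true_and]
    have hsum := sum_pow_filter_pow_succ_eq_self_ne_zero_iff (F := F) p (hpos j) (hNdvd j)
      (a j + b j * p ^ e)
    rw [hsucc] at hsum
    rw [hsum, hswap]
    simp [Nat.pos_iff_ne_zero, hp.ne_zero, and_assoc, ← not_and_or]
end

section
/- Let p be a prime, q = p^r, s a positive divisor of r, and N > 1 an integer such that N − 1 divides q − 1. Consider the cyclotomic cosets modulo N − 1 with respect to p^s, with minimal representatives 0 = a_0 < a_1 < ⋯ < a_z. For 1 ≤ i ≤ z, let a_{N(i)} denote the minimal representative of the cyclotomic coset containing N − 1 − a_i. Let t_1 be an index with 1 ≤ t_1 < z such that a_{t_1} < min { a_{N(i)} : 1 ≤ i ≤ t_1 }. Put Δ = I_{a_1} ∪ I_{a_2} ∪ ⋯ ∪ I_{a_{t_1}} and let C = E_Δ ∩ F_{p^s}^{N−1} be the subfield-subcode of the code E_Δ ⊆ F_q^{N−1} (evaluation at the (N−1)-th roots of unity in F_q). Then C ⊆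 C^⊥ (Euclidean duality), dim_{F_{p^s}} C = card(Δ), and every nonzero codeword of C^⊥ has Hamming weight at least a_{t_1+1}. -/
/-- The set `U` of `n`-th roots of unity in `F` (the evaluation points). -/
def rootsSet (F : Type) [Field F] [Fintype F] [DecidableEq F] (n : ℕ) : Finset F :=
  Finset.univ.filter (fun α => α ^ n = 1)

/-- The evaluation code `E_Δ ⊆ F^{n}`: the `F`-span of the vectors `(α^d)_{α ∈ U}`, `d ∈ Δ`. -/
noncomputable def evalCode (F : Type) [Field F] [Fintype F] [DecidableEq F] (n : ℕ)
    (Δ : Set ℕ) : Submodule F (↥(rootsSet F n) → F) :=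
  Submodule.span F { v | ∃ d ∈ Δ, v = fun α : ↥(rootsSet F n) => (α : F) ^ d }

/-- The subfield-subcode `E_Δ ∩ F_{q₀}^n`. -/
noncomputable def subfieldSubcode (F : Type) [Field F] [Fintype F] [DecidableEq F]
    (n q₀ : ℕ) (Δ : Set ℕ) : Set (↥(rootsSet F n) → F) :=
  { v | v ∈ evalCode F n Δ ∧ ∀ i, v i ^ q₀ = v i }

/-- `x` is the minimal representative of its cyclotomic coset modulo `n`
with respect to `b`. -/
def IsMinRep (b n x : ℕ) : Prop :=
  x < n ∧ ∀ i : ℕ, x ≤ (x * b ^ i) % n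

/-- The union `Δ = I_{a 1} ∪ ⋯ ∪ I_{a t}` of cyclotomic cosets. -/
def unionCosets (b n t : ℕ) (a : ℕ → ℕ) : Set ℕ :=
  { x | ∃ i, 1 ≤ i ∧ i ≤ t ∧ ∃ k : ℕ, x = (a i * b ^ k) % n }

theorem exists_isPrimitiveRoot_of_dvd_card_sub_one {F : Type*} [Field F] [Fintype F] {n : ℕ}
    (h : n ∣ Fintype.card F - 1) : ∃ ζ : F, IsPrimitiveRoot ζ n := by
  obtain ⟨g, hg⟩ := IsCyclic.exists_ofOrder_eq_natCard (α := Fˣ)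
  rw [Nat.card_units, Nat.card_eq_fintype_card] at hg
  obtain ⟨m, hm⟩ := h
  have hpos : 0 < Fintype.card F - 1 := Nat.sub_pos_of_lt Fintype.one_lt_card
  have hgp : IsPrimitiveRoot g (Fintype.card F - 1) := hg ▸ IsPrimitiveRoot.orderOf g
  exact ⟨_, (IsPrimitiveRoot.coe_units_iff.2 hgp).pow hpos (by rw [hm, mul_comm])⟩

theorem natCard_pow_eq_self {F : Type*} [Field F] [Fintype F] {b : ℕ} (hb : 2 ≤ b)
    (h : b - 1 ∣ Fintype.card F - 1) : Nat.card {x : F | x ^ b = x} = b := by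
  classical
  obtain ⟨ζ, hζ⟩ := exists_isPrimitiveRoot_of_dvd_card_sub_one h
  have hset : {x : F | x ^ b = x} = ↑(insert 0 (Polynomial.nthRootsFinset (b - 1) (1 : F))) := by
    ext x
    obtain ⟨c, rfl⟩ : ∃ c, b = c + 2 := ⟨b - 2, by omega⟩
    rw [Finset.coe_insert, Set.mem_insert_iff, Finset.mem_coe,
      Polynomial.mem_nthRootsFinset (by omega), Set.mem_ofPred_eq]
    by_cases hx : x = 0
    · simp [hx]
    · simp only [hx, false_or]
      rw [show c + 2 = (c + 1) + 1 by rfl, pow_succ, mul_eq_right₀ hx]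
      rfl
  rw [hset, Nat.card_coe_set_eq, Set.ncard_coe_finset, Finset.card_insert_of_notMem,
    hζ.card_nthRootsFinset]
  · omega
  · rw [Polynomial.mem_nthRootsFinset (by omega)]
    simp [show b - 1 ≠ 0 by omega]

/-- Galois descent: a Frobenius-stable subspace is spanned by its Frobenius-fixed vectors. -/
theorem le_span_frobenius_fixed {F ι : Type*} [Field F] [Fintype F] {b R : ℕ} (hb : 2 ≤ b)
    (hR : 0 < R) (hcard : Fintype.card F = b ^ R) (σ : F →+* F) (hσ : ∀ x, σ x = x ^ b)
    (V : Submodule F (ι → F)) (hV : ∀ v ∈ V, (fun i => v i ^ b) ∈ V) :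
    V ≤ Submodule.span F {v | v ∈ V ∧ ∀ i, v i ^ b = v i} := by
  intro v hv
  by_contra hvW
  obtain ⟨f, hfv, hf⟩ := Submodule.exists_le_ker_of_notMem hvW
  have hpow : ∀ k, (fun i => v i ^ b ^ k) ∈ V := by
    intro k
    induction k with
    | zero => simpa using hv
    | succ k ih => simpa only [pow_succ, pow_mul] using hV _ ih
  have htrace : ∀ β : F, ∑ k ∈ Finset.range R, β ^ b ^ k * f (fun i => v i ^ b ^ k) = 0 := by
    intro β
    have hmem : (∑ k ∈ Finset.range R, β ^ b ^ k • (fun i => v i ^ b ^ k)) ∈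
        {v | v ∈ V ∧ ∀ i, v i ^ b = v i} := by
      refine ⟨Submodule.sum_mem _ fun k _ => V.smul_mem _ (hpow k), fun i => ?_⟩
      simp only [Finset.sum_apply, Pi.smul_apply, smul_eq_mul]
      rw [← hσ, map_sum]
      simp only [hσ, ← mul_pow, ← pow_mul, ← pow_succ]
      have h1 := Finset.sum_range_succ (fun k => (β * v i) ^ b ^ k) R
      have h2 := Finset.sum_range_succ' (fun k => (β * v i) ^ b ^ k) R
      rw [h1, ← hcard, FiniteField.pow_card, pow_zero, pow_one] at h2
      exact (add_right_cancel h2).symm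
    have := hf (Submodule.subset_span hmem)
    simpa [LinearMap.mem_ker, map_sum] using this
  let P : Polynomial F :=
    ∑ k ∈ Finset.range R, Polynomial.monomial (b ^ k) (f (fun i => v i ^ b ^ k))
  have hP : P = 0 := by
    refine Polynomial.eq_zero_of_natDegree_lt_card_of_eval_eq_zero P Function.injective_id
      (fun β => ?_) ?_
    · rw [← htrace β]
      simp [P, Polynomial.eval_finsetSum, mul_comm]
    · rw [hcard]
      refine (Polynomial.natDegree_sum_le_of_forall_le (n := b ^ (R - 1)) _ _
        fun k hk => ?_).trans_lt
        (Nat.pow_lt_pow_right (by omega) (by omega))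
      refine (Polynomial.natDegree_monomial_le _).trans (Nat.pow_le_pow_right (by omega) ?_)
      have := Finset.mem_range.1 hk
      omega
  apply hfv
  have hcoeff : P.coeff 1 = f v := by
    simp only [P, Polynomial.finsetSum_coeff, Polynomial.coeff_monomial]
    rw [Finset.sum_eq_single_of_mem 0 (Finset.mem_range.2 hR)]
    · simp
    · intro k _ hk
      rw [if_neg]
      exact (Nat.one_lt_pow hk (by omega)).ne'
  rw [← hcoeff, hP, Polynomial.coeff_zero]

theorem natCard_frobenius_fixed {F ι : Type*} [Field F] [Fintype F] [Finite ι] {b R : ℕ}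
    (hb : 2 ≤ b) (hR : 0 < R) (hcard : Fintype.card F = b ^ R) (σ : F →+* F)
    (hσ : ∀ x, σ x = x ^ b) (V : Submodule F (ι → F)) (hV : ∀ v ∈ V, (fun i => v i ^ b) ∈ V) :
    Nat.card {v | v ∈ V ∧ ∀ i, v i ^ b = v i} = b ^ Module.finrank F V := by
  let K : Subfield F := σ.eqLocusField (RingHom.id F)
  have hK : ∀ x, x ∈ K ↔ x ^ b = x := fun x => by
    rw [RingHom.mem_eqLocusField, hσ, RingHom.id_apply]
  have hcardK : Nat.card K = b := by
    rw [← natCard_pow_eq_self hb (F := F) (by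
      rw [hcard]; simpa using Nat.sub_dvd_pow_sub_pow b 1 R)]
    exact Nat.card_congr (Equiv.subtypeEquivRight hK)
  let C : Submodule K (ι → F) :=
    { carrier := {v | v ∈ V ∧ ∀ i, v i ^ b = v i}
      add_mem' := fun {u v} hu hv => ⟨V.add_mem hu.1 hv.1, fun i => by
        rw [Pi.add_apply, ← hσ, map_add, hσ, hσ, hu.2, hv.2]⟩
      zero_mem' := ⟨V.zero_mem, fun i => by simp [show b ≠ 0 by omega]⟩
      smul_mem' := fun c v hv => ⟨V.smul_mem (c : F) hv.1, fun i => by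
        change ((c : F) * v i) ^ b = (c : F) * v i
        rw [mul_pow, hv.2, (hK c).1 c.2]⟩ }
  have hC : Nat.card {v | v ∈ V ∧ ∀ i, v i ^ b = v i} = b ^ Module.finrank K C := by
    have := Module.natCard_eq_pow_finrank (K := K) (V := C)
    rwa [hcardK] at this
  rw [hC]
  congr 1
  let e := Module.finBasis K C
  let w : Fin (Module.finrank K C) → ι → K := fun k i => ⟨(e k : ι → F) i, (hK _).2 ((e k).2.2 i)⟩
  have hw : (fun k => algebraMap K F ∘ w k) = fun k => (e k : ι → F) := rfl
  have hindep : LinearIndependent F fun k => (e k : ι → F) := by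
    rw [← hw, linearIndependent_algebraMap_comp_iff]
    have he : LinearIndependent K fun k => (e k : ι → F) :=
      e.linearIndependent.map' C.subtype C.ker_subtype
    exact LinearIndependent.of_comp ((Algebra.linearMap K F).compLeft ι) he
  have hspan : Submodule.span F (Set.range fun k => (e k : ι → F)) = V := by
    refine le_antisymm (Submodule.span_le.2 ?_) ?_
    · rintro _ ⟨k, rfl⟩
      exact (e k).2.1
    · refine (le_span_frobenius_fixed hb hR hcard σ hσ V hV).trans (Submodule.span_le.2 ?_)
      intro v hv
      have h := Submodule.mem_map_of_mem (f := C.subtype) (e.mem_span ⟨v, hv⟩)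
      rw [Submodule.map_span, ← Set.range_comp] at h
      exact Submodule.span_le_restrictScalars K F _ h
  rw [← hspan, finrank_span_eq_card hindep, Fintype.card_fin]

theorem card_rootsSet {F : Type} [Field F] [Fintype F] [DecidableEq F] {n : ℕ} (hn : 0 < n)
    (h : n ∣ Fintype.card F - 1) : (rootsSet F n).card = n := by
  obtain ⟨ζ, hζ⟩ := exists_isPrimitiveRoot_of_dvd_card_sub_one h
  have hset : rootsSet F n = Polynomial.nthRootsFinset n (1 : F) := by
    ext x
    simp [rootsSet, Polynomial.mem_nthRootsFinset hn]
  rw [hset, hζ.card_nthRootsFinset]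

theorem finrank_evalCode {F : Type} [Field F] [Fintype F] [DecidableEq F] {n : ℕ} (hn : 0 < n)
    (h : n ∣ Fintype.card F - 1) {Δ : Set ℕ} (hΔ : ∀ d ∈ Δ, d < n) :
    Module.finrank F (evalCode F n Δ) = Nat.card Δ := by
  have : Finite Δ := (Set.finite_Iio n).subset hΔ
  have : Fintype Δ := Fintype.ofFinite Δ
  let m : Δ → ↥(rootsSet F n) → F := fun d α => (α : F) ^ (d : ℕ)
  have hspan : evalCode F n Δ = Submodule.span F (Set.range m) := by
    unfold evalCode
    congr 1
    ext v
    simp [m, eq_comm]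
  rw [hspan, finrank_span_eq_card, Nat.card_eq_fintype_card]
  rw [Fintype.linearIndependent_iff]
  intro c hc d
  let P : Polynomial F := ∑ d : Δ, Polynomial.monomial (d : ℕ) (c d)
  have hP : P = 0 := by
    refine Polynomial.eq_zero_of_natDegree_lt_card_of_eval_eq_zero' P (rootsSet F n)
      (fun x hx => ?_) ?_
    · have := congrFun hc ⟨x, hx⟩
      simpa [P, m, Polynomial.eval_finsetSum] using this
    · rw [card_rootsSet hn h]
      refine (Polynomial.natDegree_sum_le_of_forall_le (n := n - 1) _ _ fun k _ => ?_).trans_lt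
        (by omega)
      refine (Polynomial.natDegree_monomial_le _).trans ?_
      have := hΔ k k.2
      omega
  have hcoeff : P.coeff d = c d := by
    simp only [P, Polynomial.finsetSum_coeff, Polynomial.coeff_monomial]
    rw [Finset.sum_eq_single_of_mem d (Finset.mem_univ d)]
    · simp
    · intro k _ hk
      rw [if_neg (fun h => hk (Subtype.ext h))]
  rw [← hcoeff, hP, Polynomial.coeff_zero]

theorem sum_rootsSet_pow_eq_zero {F : Type} [Field F] [Fintype F] [DecidableEq F] {n m : ℕ}
    (h : n ∣ Fintype.card F - 1) (hm : ¬ n ∣ m) : ∑ α : ↥(rootsSet F n), (α : F) ^ m = 0 := by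
  obtain ⟨ζ, hζ⟩ := exists_isPrimitiveRoot_of_dvd_card_sub_one h
  have hζm : ζ ^ m ≠ 1 := fun h => hm (hζ.dvd_of_pow_eq_one m h)
  have hζ0 : ζ ≠ 0 := by
    rintro rfl
    have h1 := hζ.pow_eq_one
    rcases Nat.eq_zero_or_pos n with rfl | hn
    · have := Nat.sub_pos_of_lt (Fintype.one_lt_card (α := F))
      rw [zero_dvd_iff] at h
      omega
    · simp [hn.ne'] at h1
  have hperm : ∑ α ∈ rootsSet F n, α ^ m = ∑ α ∈ rootsSet F n, (ζ * α) ^ m := by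
    symm
    refine Finset.sum_bijective (ζ * ·) (mulLeft_bijective₀ ζ hζ0) (fun α => ?_) (fun _ _ => rfl)
    simp [rootsSet, mul_pow, hζ.pow_eq_one]
  rw [Finset.sum_coe_sort (rootsSet F n) (fun α => α ^ m)]
  simp only [mul_pow, ← Finset.mul_sum] at hperm
  by_contra hne
  exact hζm ((mul_eq_right₀ hne).1 hperm.symm)

/-- The BCH bound. -/
theorem le_card_support_of_sum_mul_pow_eq_zero {F ι : Type*} [Field F] [DecidableEq F] [Fintype ι]
    {g : ι → F} (hg : Function.Injective g) (hg0 : ∀ i, g i ≠ 0) {δ : ℕ} {y : ι → F} (hy : y ≠ 0)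
    (h : ∀ d, 1 ≤ d → d < δ → ∑ i, g i ^ d * y i = 0) :
    δ ≤ (Finset.univ.filter (fun i => y i ≠ 0)).card := by
  classical
  by_contra! hlt
  set S := Finset.univ.filter (fun i => y i ≠ 0) with hS
  obtain ⟨j, hj⟩ := Function.ne_iff.1 hy
  have hjS : j ∈ S := by simpa [hS] using hj
  let Q : Polynomial F := ∏ i ∈ S.erase j, (Polynomial.X - Polynomial.C (g i))
  have hQ : Q.natDegree + 1 = S.card := by
    rw [Polynomial.natDegree_finsetProd_X_sub_C_eq_card, Finset.card_erase_add_one hjS]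
  have hsum : ∑ i, g i * Q.eval (g i) * y i = 0 := by
    simp only [Polynomial.eval_eq_sum_range, Finset.mul_sum, Finset.sum_mul]
    rw [Finset.sum_comm]
    refine Finset.sum_eq_zero fun d hd => ?_
    have hd' := Finset.mem_range.1 hd
    have := h (d + 1) (by omega) (by omega)
    calc _ = ∑ i, Q.coeff d * (g i ^ (d + 1) * y i) :=
          Finset.sum_congr rfl fun i _ => by ring
      _ = 0 := by rw [← Finset.mul_sum, this, mul_zero]
  rw [Finset.sum_eq_single_of_mem j (Finset.mem_univ j)] at hsum
  · refine mul_ne_zero (mul_ne_zero (hg0 j) ?_) hj hsum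
    rw [Polynomial.eval_prod, Finset.prod_ne_zero_iff]
    intro i hi
    simpa [sub_eq_zero] using fun h => Finset.ne_of_mem_erase hi (hg h).symm
  · intro i _ hij
    by_cases hi : y i = 0
    · rw [hi, mul_zero]
    · have : Q.eval (g i) = 0 := by
        rw [Polynomial.eval_prod]
        exact Finset.prod_eq_zero (Finset.mem_erase.2 ⟨hij, by simpa [hS] using hi⟩) (by simp)
      rw [this, mul_zero, zero_mul]

theorem sum_mul_eq_zero_of_mem_span {F ι : Type*} [Field F] [Fintype ι] {S : Set (ι → F)}
    {y : ι → F} (h : ∀ v ∈ S, ∑ i, v i * y i = 0) {x : ι → F} (hx : x ∈ Submodule.span F S) :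
    ∑ i, x i * y i = 0 := by
  induction hx using Submodule.span_induction with
  | mem v hv => exact h v hv
  | zero => simp
  | add u v _ _ hu hv => simp only [Pi.add_apply, add_mul, Finset.sum_add_distrib, hu, hv, add_zero]
  | smul c v _ hv =>
    simp only [Pi.smul_apply, smul_eq_mul, mul_assoc, ← Finset.mul_sum, hv, mul_zero]

theorem frobenius_mem_evalCode {F : Type} [Field F] [Fintype F] [DecidableEq F] {n b : ℕ}
    (σ : F →+* F) (hσ : ∀ x, σ x = x ^ b) {Δ : Set ℕ} (hΔ : ∀ d ∈ Δ, (d * b) % n ∈ Δ)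
    {v : ↥(rootsSet F n) → F} (hv : v ∈ evalCode F n Δ) : (fun i => v i ^ b) ∈ evalCode F n Δ := by
  simp only [← hσ]
  unfold evalCode at hv
  induction hv using Submodule.span_induction with
  | mem v hv =>
    obtain ⟨d, hd, rfl⟩ := hv
    refine Submodule.subset_span ⟨_, hΔ d hd, funext fun α => ?_⟩
    have hα : (α : F) ^ n = 1 := (Finset.mem_filter.1 α.2).2
    rw [hσ, ← pow_mul, pow_eq_pow_mod _ hα]
  | zero =>
    simp only [Pi.zero_apply, map_zero]
    exact (evalCode F n Δ).zero_mem
  | add u v _ _ hu hv =>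
    simp only [Pi.add_apply, map_add]
    exact (evalCode F n Δ).add_mem hu hv
  | smul c v _ hv =>
    simp only [Pi.smul_apply, smul_eq_mul, map_mul]
    exact (evalCode F n Δ).smul_mem (σ c) hv

theorem exists_modEq_mul_pow_symm {b n R x y k : ℕ} (hb : b ^ R ≡ 1 [MOD n]) (hR : 0 < R)
    (h : x * b ^ k ≡ y [MOD n]) : ∃ l, y * b ^ l ≡ x [MOD n] := by
  refine ⟨k * (R - 1), ?_⟩
  calc y * b ^ (k * (R - 1)) ≡ x * b ^ k * b ^ (k * (R - 1)) [MOD n] := h.symm.mul_right _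
    _ = x * (b ^ R) ^ k := by
      obtain ⟨R, rfl⟩ : ∃ R', R = R' + 1 := ⟨R - 1, by omega⟩
      rw [Nat.add_sub_cancel]
      ring
    _ ≡ x * 1 ^ k [MOD n] := (hb.pow k).mul_left x
    _ = x := by simp

theorem IsMinRep.le_of_modEq {b n u v k : ℕ} (hu : IsMinRep b n u) (hv : v < n)
    (h : u * b ^ k ≡ v [MOD n]) : u ≤ v := by
  have := hu.2 k
  rwa [h, Nat.mod_eq_of_lt hv] at this

theorem IsMinRep.eq_of_modEq {b n R u v k : ℕ} (hb : b ^ R ≡ 1 [MOD n]) (hR : 0 < R)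
    (hu : IsMinRep b n u) (hv : IsMinRep b n v) (h : u * b ^ k ≡ v [MOD n]) : u = v := by
  obtain ⟨l, hl⟩ := exists_modEq_mul_pow_symm hb hR h
  exact le_antisymm (hu.le_of_modEq hv.1 h) (hv.le_of_modEq hu.1 hl)

theorem exists_isMinRep {b n : ℕ} (hn : 0 < n) (x : ℕ) :
    ∃ m k, IsMinRep b n m ∧ x * b ^ k ≡ m [MOD n] ∧ m ≤ x := by
  obtain ⟨k, hk⟩ := Nat.sInf_mem (Set.range_nonempty fun k => (x * b ^ k) % n)
  have hle : ∀ j, (x * b ^ k) % n ≤ (x * b ^ j) % n := fun j => by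
    rw [show (x * b ^ k) % n = _ from hk]
    exact Nat.sInf_le ⟨j, rfl⟩
  refine ⟨(x * b ^ k) % n, k, ⟨Nat.mod_lt _ hn, fun i => ?_⟩, (Nat.mod_modEq _ _).symm, ?_⟩
  · rw [Nat.mod_mul_mod, mul_assoc, ← pow_add]
    exact hle _
  · exact (hle 0).trans (by simpa using Nat.mod_le x n)

/-- Theorem 3 of the paper: self-orthogonality, dimension and designed
distance of the subfield-subcode over `F_{p^s}` of the univariate code of length `N - 1`
given by the union `Δ` of the first `t₁` nonzero cyclotomic cosets, under the
condition `a_{t₁} < min { a_{N(i)} : 1 ≤ i ≤ t₁ }`. -/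
theorem univariate_subfield_subcode_euclidean_general_length
    (p r s z t₁ N : ℕ) (hp : p.Prime) (hr : 0 < r) (hs : 0 < s) (hsr : s ∣ r)
    (hN : 1 < N) (hNdvd : (N - 1) ∣ (p ^ r - 1))
    (F : Type) [Field F] [Fintype F] [DecidableEq F]
    (hF : Fintype.card F = p ^ r)
    (a : ℕ → ℕ)
    (hmono : StrictMonoOn a (Set.Iic z))
    (hreps : ∀ x : ℕ, (∃ i ≤ z, a i = x) ↔ IsMinRep (p ^ s) (N - 1) x)
    (aN : ℕ → ℕ)
    (haN : ∀ i, 1 ≤ i → i ≤ z →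
      IsMinRep (p ^ s) (N - 1) (aN i) ∧
      ∃ k : ℕ, aN i = ((N - 1 - a i) * (p ^ s) ^ k) % (N - 1))
    (ht₁ : 1 ≤ t₁) (ht₁z : t₁ < z)
    (hbound : ∀ i, 1 ≤ i → i ≤ t₁ → a t₁ < aN i) :
    (∀ x ∈ subfieldSubcode F (N - 1) (p ^ s) (unionCosets (p ^ s) (N - 1) t₁ a),
     ∀ y ∈ subfieldSubcode F (N - 1) (p ^ s) (unionCosets (p ^ s) (N - 1) t₁ a),
      ∑ i, x i * y i = 0) ∧
    Nat.card (subfieldSubcode F (N - 1) (p ^ s) (unionCosets (p ^ s) (N - 1) t₁ a)) =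
      (p ^ s) ^ (Nat.card (unionCosets (p ^ s) (N - 1) t₁ a)) ∧
    (∀ y : ↥(rootsSet F (N - 1)) → F,
      (∀ i, y i ^ (p ^ s) = y i) →
      (∀ x ∈ subfieldSubcode F (N - 1) (p ^ s) (unionCosets (p ^ s) (N - 1) t₁ a),
        ∑ i, x i * y i = 0) →
      y ≠ 0 →
      a (t₁ + 1) ≤ (Finset.univ.filter (fun i => y i ≠ 0)).card) := by
  have hb : 2 ≤ p ^ s := hp.two_le.trans (Nat.le_self_pow hs.ne' p)
  obtain ⟨R, rfl⟩ := hsr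
  have hR : 0 < R := Nat.pos_of_mul_pos_left hr
  have hcharP : CharP F p := by
    have := Fact.mk hp
    exact charP_of_card_eq_prime_pow hF
  have hprime := Fact.mk hp
  set σ : F →+* F := iterateFrobenius F p s
  rw [pow_mul] at hF hNdvd
  have hσ : ∀ x, σ x = x ^ p ^ s := fun x => iterateFrobenius_def p s x
  clear_value σ
  generalize p ^ s = b at *
  have hn : 0 < N - 1 := by omega
  generalize N - 1 = n at *
  rw [← hF] at hNdvd
  have hbR : b ^ R ≡ 1 [MOD n] :=
    ((Nat.modEq_iff_dvd' (Nat.one_le_pow _ _ (by omega))).2 (hF ▸ hNdvd)).symm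
  have hmin : ∀ i ≤ z, IsMinRep b n (a i) := fun i hi => (hreps _).1 ⟨i, hi, rfl⟩
  have hinj : ∀ i ≤ z, ∀ j ≤ z, a i < a j → i < j := fun i hi j hj h =>
    (hmono.lt_iff_lt hi hj).1 h
  have ha0 : a 0 = 0 := by
    obtain ⟨i, hi, hai⟩ := (hreps 0).2 ⟨hn, fun i => Nat.zero_le _⟩
    have := (hmono.le_iff_le (Set.mem_Iic.2 (Nat.zero_le z)) (Set.mem_Iic.2 hi)).2 (Nat.zero_le i)
    omega
  set Δ := unionCosets b n t₁ a
  have hΔlt : ∀ d ∈ Δ, d < n := by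
    rintro d ⟨i, -, -, k, rfl⟩
    exact Nat.mod_lt _ hn
  have hΔstable : ∀ d ∈ Δ, (d * b) % n ∈ Δ := by
    rintro d ⟨i, h1, h2, k, rfl⟩
    exact ⟨i, h1, h2, k + 1, by rw [Nat.mod_mul_mod, mul_assoc, ← pow_succ]⟩
  have hΔadd : ∀ d ∈ Δ, ∀ e ∈ Δ, ¬ n ∣ d + e := by
    rintro d ⟨i, hi1, hit, k, rfl⟩ e ⟨j, hj1, hjt, l, rfl⟩ hdvd
    obtain ⟨haNi, m, hm⟩ := haN i hi1 (by omega)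
    have hlt := (hmin i (by omega)).1
    have hij : a i * b ^ k + a j * b ^ l ≡ 0 [MOD n] :=
      ((Nat.mod_modEq _ _).symm.add (Nat.mod_modEq _ _).symm).trans
        (Nat.modEq_zero_iff_dvd.2 hdvd)
    have hneg : (n - a i) * b ^ k ≡ a j * b ^ l [MOD n] := by
      refine Nat.ModEq.add_left_cancel' (a i * b ^ k) (Nat.ModEq.trans ?_ hij.symm)
      rw [← add_mul, Nat.add_sub_cancel' hlt.le]
      exact Nat.modEq_zero_iff_dvd.2 (dvd_mul_right _ _)
    obtain ⟨l', hl'⟩ := exists_modEq_mul_pow_symm hbR hR hneg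
    have hchain : a j * b ^ (l + l' + m) ≡ aN i [MOD n] := by
      calc a j * b ^ (l + l' + m) = a j * b ^ l * b ^ l' * b ^ m := by ring
        _ ≡ (n - a i) * b ^ m [MOD n] := hl'.mul_right _
        _ ≡ aN i [MOD n] := by rw [hm]; exact (Nat.mod_modEq _ _).symm
    have heq := (hmin j (by omega)).eq_of_modEq hbR hR haNi hchain
    have hle := (hmono.le_iff_le (Set.mem_Iic.2 (by omega : j ≤ z))
      (Set.mem_Iic.2 (by omega : t₁ ≤ z))).2 hjt
    have := hbound i hi1 hit
    omega
  have hΔmem : ∀ d, 1 ≤ d → d < a (t₁ + 1) → d ∈ Δ := by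
    intro d hd1 hd
    have hdn : d < n := hd.trans (hmin _ (by omega)).1
    obtain ⟨m, k, hm, hk, hmd⟩ := exists_isMinRep (b := b) hn d
    obtain ⟨i, hi, rfl⟩ := (hreps m).2 hm
    have hit := hinj i hi (t₁ + 1) (by omega) (by omega)
    obtain ⟨l, hl⟩ := exists_modEq_mul_pow_symm hbR hR hk
    have hdl : d = (a i * b ^ l) % n := by rw [hl, Nat.mod_eq_of_lt hdn]
    refine ⟨i, Nat.one_le_iff_ne_zero.2 ?_, by omega, l, hdl⟩
    rintro rfl
    rw [ha0, zero_mul, Nat.zero_mod] at hdl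
    omega
  have hfrob : ∀ v ∈ evalCode F n Δ, (fun i => v i ^ b) ∈ evalCode F n Δ :=
    fun v hv => frobenius_mem_evalCode σ hσ hΔstable hv
  refine ⟨fun x hx y hy => ?_, ?_, fun y _ hy hy0 => ?_⟩
  · refine sum_mul_eq_zero_of_mem_span ?_ hx.1
    rintro _ ⟨d, hd, rfl⟩
    simp only [mul_comm (_ ^ d)]
    refine sum_mul_eq_zero_of_mem_span ?_ hy.1
    rintro _ ⟨e, he, rfl⟩
    simp only [← pow_add]
    exact sum_rootsSet_pow_eq_zero hNdvd (hΔadd e he d hd)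
  · rw [← finrank_evalCode hn hNdvd hΔlt]
    exact natCard_frobenius_fixed hb hR hF σ hσ _ hfrob
  · refine le_card_support_of_sum_mul_pow_eq_zero (g := fun α : ↥(rootsSet F n) => (α : F))
      Subtype.val_injective (fun α h0 => ?_) hy0 fun d hd1 hd => ?_
    · have hα : (α : F) ^ n = 1 := (Finset.mem_filter.1 α.2).2
      simp [h0, hn.ne'] at hα
    · exact sum_mul_eq_zero_of_mem_span hy (le_span_frobenius_fixed hb hR hF σ hσ _ hfrob
        (Submodule.subset_span ⟨d, hΔmem d hd1 hd, rfl⟩))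
end
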